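/- With θ as specified (Example 5.2), the following hold: (i) there exist constants 0 < c ≤ C < ∞ such that c λ^{α₁} ≤ π(λ) ≤ C λ^{α₁} for all sufficiently large λ; (ii) there exist constants 0 < c' ≤ C' < ∞ such that c' λ^{α₁} ≤ ψ(λ) ≤ C' λ^{α₁} for all sufficiently large λ; (iii) Condition (C1) fails, since limsup_{x→0} (x/θ(x))/π(1/x) = ∞. -/

import Mathlib

open MeasureTheory Filter Set Topology

/-- The tail function of the Lévy measure ν(dx) = dx/θ(x):
    π(x) = 2∫_{1/x}^∞ dz/θ(z). -/
noncomputable def piF (θ : ℝ → ℝ) (x : ℝ) : ℝ :=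
  2 * ∫ z in Set.Ioi (1 / x), 1 / θ z

/-- The characteristic exponent ψ(λ) = ∫₀^∞ (1 − cos(xλ)) dx/θ(x). -/
noncomputable def psiF (θ : ℝ → ℝ) (l : ℝ) : ℝ :=
  ∫ x in Set.Ioi (0 : ℝ), (1 - Real.cos (x * l)) / θ x

/-- φ(x) = 2∫_{1/x}^∞ dλ/ψ(λ). -/
noncomputable def phiF (θ : ℝ → ℝ) (x : ℝ) : ℝ :=
  2 * ∫ l in Set.Ioi (1 / x), 1 / psiF θ l

/-- σ₀²(x) = (2/π)∫₀^∞ (1 − cos(λx)) dλ/ψ(λ). -/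
noncomputable def sigma0sq (θ : ℝ → ℝ) (x : ℝ) : ℝ :=
  (2 / Real.pi) * ∫ l in Set.Ioi (0 : ℝ), (1 - Real.cos (l * x)) / psiF θ l

/-- σ̂₀²(h) = sup_{|x| ≤ h} σ₀²(x). -/
noncomputable def sigma0sqHat (θ : ℝ → ℝ) (h : ℝ) : ℝ :=
  sSup (sigma0sq θ '' {x : ℝ | |x| ≤ h})

/-- H(x) = ∫₀^∞ min(1, (λ/x)²) dλ/ψ(λ). -/
noncomputable def Hfun (θ : ℝ → ℝ) (x : ℝ) : ℝ :=
  ∫ l in Set.Ioi (0 : ℝ), min 1 ((l / x) ^ 2) / psiF θ l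

/-- Standing assumptions on θ: measurability, positivity on (0,∞), and
    ∫₀^∞ min(1, x²)/θ(x) dx < ∞, so that ν(dx) = dx/θ(x) is the Lévy measure of
    a symmetric pure-jump Lévy process. -/
def ThetaOK (θ : ℝ → ℝ) : Prop :=
  Measurable θ ∧ (∀ x ∈ Set.Ioi (0 : ℝ), 0 < θ x) ∧
    MeasureTheory.IntegrableOn (fun x => min 1 (x ^ 2) / θ x) (Set.Ioi 0)

/-- Existence of local times: ∫₁^∞ dλ/ψ(λ) < ∞. -/
def PsiIntegrable (θ : ℝ → ℝ) : Prop :=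
  MeasureTheory.IntegrableOn (fun l => 1 / psiF θ l) (Set.Ioi 1)

/-- Condition (C1): 1 < α̲ ≤ ᾱ < 2, where α̲ and ᾱ are the liminf and the limsup, as
    x → 0⁺, of (x/θ(x))/ν({z : |z| ≥ x}) = (x/θ(x))/π(1/x) (which is in particular
    eventually bounded above since the limsup is finite). -/
def CondC1 (θ : ℝ → ℝ) (al ah : ℝ) : Prop :=
  1 < al ∧ al ≤ ah ∧ ah < 2 ∧
  Filter.IsBoundedUnder (· ≤ ·) (𝓝[>] (0 : ℝ))
    (fun x => (x / θ x) / piF θ (1 / x)) ∧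
  Filter.liminf (fun x => (x / θ x) / piF θ (1 / x)) (𝓝[>] (0 : ℝ)) = al ∧
  Filter.limsup (fun x => (x / θ x) / piF θ (1 / x)) (𝓝[>] (0 : ℝ)) = ah

/-- Condition (C2): 1 < β̲ ≤ β̄ < 2, where β̲ and β̄ are the liminf and the limsup, as
    x → ∞, of (x/θ(x))/ν({z : |z| ≥ x}) = (x/θ(x))/π(1/x). -/
def CondC2 (θ : ℝ → ℝ) (bl bh : ℝ) : Prop :=
  1 < bl ∧ bl ≤ bh ∧ bh < 2 ∧
  Filter.IsBoundedUnder (· ≤ ·) Filter.atTop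
    (fun x => (x / θ x) / piF θ (1 / x)) ∧
  Filter.liminf (fun x => (x / θ x) / piF θ (1 / x)) Filter.atTop = bl ∧
  Filter.limsup (fun x => (x / θ x) / piF θ (1 / x)) Filter.atTop = bh

/-- Example 5.2: with θ as specified, (i) π(λ) ≍ λ^{α₁} for large λ; (ii) ψ(λ) ≍ λ^{α₁}
    for large λ; (iii) Condition (C1) fails, since
    limsup_{x→0} (x/θ(x))/ν({z : |z| ≥ x}) = ∞. -/
theorem example_5_2 (a1 a2 : ℝ) (ha1 : 1 < a1) (ha12 : a1 < a2) (ha2 : a2 < 2)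
    (b : ℕ → ℝ) (hbanti : StrictAnti b) (hb0 : b 0 = 1) (hb1 : b 1 = 1 / 2)
    (hbpos : ∀ n, 0 < b n) (hblim : Filter.Tendsto b Filter.atTop (𝓝 0))
    (hbgap : ∀ k : ℕ, 1 ≤ k → b (2 * k) ≤ b (2 * k - 1) / (k + 1))
    (hbint1 : ∀ k : ℕ, 1 ≤ k →
      (∫ x in Set.Ioc (b (2 * k + 1)) (b (2 * k)), x ^ (-a2 - 1)) ≤
        ∫ x in Set.Ioc (b (2 * k)) (b (2 * k - 1)), x ^ (-a1 - 1))
    (hbint2 : ∀ k : ℕ, 1 ≤ k →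
      (∫ x in Set.Ioc (b (2 * k + 1)) (b (2 * k)), x ^ (-(a2 - 1))) ≤
        ∫ x in Set.Ioc (0 : ℝ) (b (2 * k + 1)), x ^ (-(a1 - 1)))
    (θ : ℝ → ℝ)
    (hθ1 : ∀ k : ℕ, ∀ x ∈ Set.Ioc (b (2 * k + 2)) (b (2 * k + 1)), θ x = x ^ (a1 + 1))
    (hθ2 : ∀ k : ℕ, ∀ x ∈ Set.Ioc (b (2 * k + 1)) (b (2 * k)), θ x = x ^ (a2 + 1))
    (hθ3 : ∀ x : ℝ, 1 < x → θ x = x ^ (a1 + 1)) :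
    (∃ c C : ℝ, 0 < c ∧ c ≤ C ∧ ∃ Λ : ℝ, ∀ l : ℝ, Λ < l →
        c * l ^ a1 ≤ piF θ l ∧ piF θ l ≤ C * l ^ a1) ∧
    (∃ c' C' : ℝ, 0 < c' ∧ c' ≤ C' ∧ ∃ Λ' : ℝ, ∀ l : ℝ, Λ' < l →
        c' * l ^ a1 ≤ psiF θ l ∧ psiF θ l ≤ C' * l ^ a1) ∧
    ((∀ M : ℝ, ∃ᶠ x in 𝓝[>] (0 : ℝ), M < (x / θ x) / piF θ (1 / x)) ∧
      ∀ al ah : ℝ, ¬ CondC1 θ al ah) := by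
  
  classical
  -- setup
  set S : Set ℝ := ⋃ k : ℕ, Set.Ioc (b (2 * k + 1)) (b (2 * k)) with hS
  have hSm : MeasurableSet S := MeasurableSet.iUnion fun k => measurableSet_Ioc
  set g : ℝ → ℝ := fun x => if x ∈ S then x ^ (-a2 - 1) else x ^ (-a1 - 1) with hg
  have hbm : ∀ m n : ℕ, m ≤ n → b n ≤ b m := fun m n h => hbanti.antitone h
  have hbad : ∀ k : ℕ, ∀ x ∈ Set.Ioc (b (2 * k + 1)) (b (2 * k)), g x = x ^ (-a2 - 1) := by
    intro k x hx
    have : x ∈ S := Set.mem_iUnion.2 ⟨k, hx⟩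
    simp only [hg, if_pos this]
  have hgood : ∀ k : ℕ, ∀ x ∈ Set.Ioc (b (2 * k + 2)) (b (2 * k + 1)), g x = x ^ (-a1 - 1) := by
    intro k x hx
    have : x ∉ S := by
      intro h
      obtain ⟨j, hj⟩ := Set.mem_iUnion.1 h
      rcases le_or_gt j k with hjk | hjk
      · have := hbm (2 * j + 1) (2 * k + 1) (by omega)
        linarith [hj.1, hx.2]
      · have := hbm (2 * k + 2) (2 * j) (by omega)
        linarith [hj.2, hx.1]
    simp only [hg, if_neg this]
  have hbig : ∀ x : ℝ, 1 < x → g x = x ^ (-a1 - 1) := by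
    intro x hx
    have : x ∉ S := by
      intro h
      obtain ⟨j, hj⟩ := Set.mem_iUnion.1 h
      have := hbm 0 (2 * j) (by omega)
      linarith [hj.2, hx]
    simp only [hg, if_neg this]
  have hloc : ∀ u : ℝ, 0 < u → u ≤ b 1 → ∃ k : ℕ, b (2 * k + 3) < u ∧ u ≤ b (2 * k + 1) := by
    intro u hu hu1
    have hex : ∃ n : ℕ, b (2 * n + 1) < u := by
      have h1 := (hblim.eventually (gt_mem_nhds hu)).exists_forall_of_atTop
      obtain ⟨N, hN⟩ := h1
      exact ⟨N, hN _ (by omega)⟩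
    have hs := Nat.find_spec hex
    rcases hn : Nat.find hex with _ | k
    · rw [hn] at hs
      simp at hs
      linarith
    · refine ⟨k, ?_, ?_⟩
      · rw [hn] at hs
        exact hs
      · have := Nat.find_min hex (m := k) (by omega)
        exact not_lt.1 this
  have hinv : ∀ x : ℝ, 0 < x → ∀ a : ℝ, 1 / x ^ (a + 1) = x ^ (-a - 1) := by
    intro x hx a
    rw [one_div, ← Real.rpow_neg hx.le]
    congr 1
    ring
  have hθg : ∀ x : ℝ, 0 < x → 1 / θ x = g x := by
    intro x hx
    rcases le_or_gt x (b 1) with h1 | h1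
    · obtain ⟨k, hk1, hk2⟩ := hloc x hx h1
      rcases le_or_gt x (b (2 * k + 2)) with h2 | h2
      · have hm : x ∈ Set.Ioc (b (2 * (k + 1) + 1)) (b (2 * (k + 1))) := ⟨hk1, h2⟩
        rw [hθ2 _ x hm, hbad _ x hm, hinv x hx]
      · rw [hθ1 k x ⟨h2, hk2⟩, hgood k x ⟨h2, hk2⟩, hinv x hx]
    · rcases le_or_gt x (b 0) with h2 | h2
      · have hm : x ∈ Set.Ioc (b (2 * 0 + 1)) (b (2 * 0)) := ⟨h1, h2⟩
        rw [hθ2 _ x hm, hbad _ x hm, hinv x hx]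
      · rw [hb0] at h2
        rw [hθ3 x h2, hbig x h2, hinv x hx]
  have hglow : ∀ x : ℝ, 0 < x → x ^ (-a1 - 1) ≤ g x := by
    intro x hx
    by_cases h : x ∈ S
    · have hx1 : x ≤ 1 := by
        obtain ⟨j, hj⟩ := Set.mem_iUnion.1 h
        have := hbm 0 (2 * j) (by omega)
        linarith [hj.2]
      simp only [hg, if_pos h]
      exact Real.rpow_le_rpow_of_exponent_ge hx hx1 (by linarith)
    · simp only [hg, if_neg h]
      exact le_rfl
  have hgup : ∀ x : ℝ, 0 < x → g x ≤ x ^ (-a1 - 1) + x ^ (-a2 - 1) := by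
    intro x hx
    have h1 := Real.rpow_nonneg hx.le (-a1 - 1)
    have h2 := Real.rpow_nonneg hx.le (-a2 - 1)
    simp only [hg]
    split_ifs <;> linarith
  have hgpos : ∀ x : ℝ, 0 < x → 0 ≤ g x := fun x hx =>
    (Real.rpow_nonneg hx.le _).trans (hglow x hx)
  have hgm : Measurable g := by
    refine Measurable.ite hSm ?_ ?_ <;> fun_prop
  have hri : ∀ a : ℝ, 1 < a → ∀ u : ℝ, 0 < u →
      IntegrableOn (fun x : ℝ => x ^ (-a - 1)) (Set.Ioi u) := fun a ha u hu =>
    integrableOn_Ioi_rpow_of_lt (by linarith) hu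
  have hgi : ∀ u : ℝ, 0 < u → IntegrableOn g (Set.Ioi u) := by
    intro u hu
    refine Integrable.mono' ((hri a1 ha1 u hu).add (hri a2 (by linarith) u hu))
      hgm.aestronglyMeasurable ?_
    refine (ae_restrict_iff' measurableSet_Ioi).2 (Eventually.of_forall fun x hx => ?_)
    have hx0 : 0 < x := hu.trans hx
    rw [Real.norm_eq_abs, abs_of_nonneg (hgpos x hx0)]
    exact hgup x hx0
  -- F and G
  set F : ℝ → ℝ := fun u => ∫ x in Set.Ioi u, g x with hF
  set G : ℝ → ℝ := fun u => ∫ x in Set.Ioi u, x ^ (-a1 - 1) with hG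
  have hGe : ∀ u : ℝ, 0 < u → G u = u ^ (-a1) / a1 := by
    intro u hu
    simp only [hG]
    rw [integral_Ioi_rpow_of_lt (by linarith) hu]
    have : -a1 - 1 + 1 = -a1 := by ring
    rw [this, neg_div_neg_eq]
  have hsplit : ∀ f : ℝ → ℝ, ∀ u v : ℝ, u ≤ v → IntegrableOn f (Set.Ioi u) →
      ∫ x in Set.Ioi u, f x = (∫ x in Set.Ioc u v, f x) + ∫ x in Set.Ioi v, f x := by
    intro f u v huv hf
    rw [← Set.Ioc_union_Ioi_eq_Ioi huv, setIntegral_union (Set.Ioc_disjoint_Ioi le_rfl)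
      measurableSet_Ioi (hf.mono_set Set.Ioc_subset_Ioi_self)
      (hf.mono_set (Set.Ioi_subset_Ioi huv))]
  have hFs : ∀ u v : ℝ, 0 < u → u ≤ v → F u = (∫ x in Set.Ioc u v, g x) + F v :=
    fun u v hu huv => hsplit g u v huv (hgi u hu)
  have hGs : ∀ u v : ℝ, 0 < u → u ≤ v → G u = (∫ x in Set.Ioc u v, x ^ (-a1 - 1)) + G v :=
    fun u v hu huv => hsplit _ u v huv (hri a1 ha1 u hu)
  have hGanti : ∀ u v : ℝ, 0 < u → u ≤ v → G v ≤ G u := by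
    intro u v hu huv
    rw [hGs u v hu huv]
    have : 0 ≤ ∫ x in Set.Ioc u v, x ^ (-a1 - 1) :=
      setIntegral_nonneg measurableSet_Ioc fun x hx => Real.rpow_nonneg (hu.trans hx.1).le _
    linarith
  have hFanti : ∀ u v : ℝ, 0 < u → u ≤ v → F v ≤ F u := by
    intro u v hu huv
    rw [hFs u v hu huv]
    have : 0 ≤ ∫ x in Set.Ioc u v, g x :=
      setIntegral_nonneg measurableSet_Ioc fun x hx => hgpos x (hu.trans hx.1)
    linarith
  have hGpos : ∀ u : ℝ, 0 < u → 0 ≤ G u := by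
    intro u hu
    rw [hGe u hu]
    have := Real.rpow_nonneg hu.le (-a1)
    positivity
  have hGF : ∀ u : ℝ, 0 < u → G u ≤ F u := fun u hu =>
    setIntegral_mono_on (hri a1 ha1 u hu) (hgi u hu) measurableSet_Ioi
      fun x hx => hglow x (hu.trans hx)
  have hgoodI : ∀ k : ℕ, ∀ u : ℝ, b (2 * k + 2) ≤ u →
      ∫ x in Set.Ioc u (b (2 * k + 1)), g x = ∫ x in Set.Ioc u (b (2 * k + 1)), x ^ (-a1 - 1) :=
    fun k u hu => setIntegral_congr_fun measurableSet_Ioc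
      fun x hx => hgood k x ⟨hu.trans_lt hx.1, hx.2⟩
  have hbadI : ∀ k : ℕ, ∫ x in Set.Ioc (b (2 * k + 1)) (b (2 * k)), g x
      = ∫ x in Set.Ioc (b (2 * k + 1)) (b (2 * k)), x ^ (-a2 - 1) :=
    fun k => setIntegral_congr_fun measurableSet_Ioc fun x hx => hbad k x hx
  set K : ℝ := F (b 1) with hK
  have hKpos : 0 ≤ K := (hGpos _ (hbpos 1)).trans (hGF _ (hbpos 1))
  have hFb : ∀ n : ℕ, F (b (2 * n + 1)) ≤ K + 2 * G (b (2 * n)) := by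
    intro n
    induction n with
    | zero =>
      have := hGpos _ (hbpos 0)
      simp only [mul_zero, zero_add]
      linarith
    | succ n ih =>
      have e1 := hFs (b (2 * n + 3)) (b (2 * n + 2)) (hbpos _) (hbm _ _ (by omega))
      have e2 := hFs (b (2 * n + 2)) (b (2 * n + 1)) (hbpos _) (hbm _ _ (by omega))
      have e3 := hGs (b (2 * n + 2)) (b (2 * n + 1)) (hbpos _) (hbm _ _ (by omega))
      have e4 := hgoodI n _ le_rfl
      have e5 := hbadI (n + 1)
      have e6 := hbint1 (n + 1) (by omega)
      have e7 := hGanti (b (2 * n + 1)) (b (2 * n)) (hbpos _) (hbm _ _ (by omega))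
      have i1 : 2 * (n + 1) + 1 = 2 * n + 3 := by ring
      have i2 : 2 * (n + 1) = 2 * n + 2 := by ring
      have i3 : 2 * (n + 1) - 1 = 2 * n + 1 := by omega
      rw [i3] at e6
      rw [i1, i2] at e5 e6
      rw [i1, i2]
      linarith
  have hFu : ∀ u : ℝ, 0 < u → u ≤ b 1 → F u ≤ K + 2 * G u := by
    intro u hu hu1
    obtain ⟨k, hk1, hk2⟩ := hloc u hu hu1
    rcases le_or_gt u (b (2 * k + 2)) with h2 | h2
    · have e1 := hFanti _ u (hbpos (2 * k + 3)) hk1.le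
      have e2 : F (b (2 * k + 3)) ≤ K + 2 * G (b (2 * k + 2)) := hFb (k + 1)
      have e3 := hGanti _ _ hu h2
      linarith
    · have e1 := hFs u (b (2 * k + 1)) hu hk2
      have e2 := hGs u (b (2 * k + 1)) hu hk2
      have e3 := hgoodI k u h2.le
      have e4 := hFb k
      have e5 := hGanti (b (2 * k + 1)) (b (2 * k)) (hbpos _) (hbm _ _ (by omega))
      have e6 := hGanti _ _ hu hk2
      linarith
  set C0 : ℝ := K + 2 / a1 with hC0
  have ha1pos : 0 < a1 := by linarith
  have hFfin : ∀ u : ℝ, 0 < u → u ≤ b 1 → F u ≤ C0 * u ^ (-a1) := by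
    intro u hu hu1
    have h1 := hFu u hu hu1
    rw [hGe u hu] at h1
    have h2 : 1 ≤ u ^ (-a1) :=
      Real.one_le_rpow_of_pos_of_le_one_of_nonpos hu (by linarith) (by linarith)
    have h3 : K ≤ K * u ^ (-a1) := le_mul_of_one_le_right hKpos h2
    calc F u ≤ K + 2 * (u ^ (-a1) / a1) := h1
      _ ≤ K * u ^ (-a1) + 2 * (u ^ (-a1) / a1) := by linarith
      _ = C0 * u ^ (-a1) := by rw [hC0]; ring
  have hpiF : ∀ l : ℝ, 0 < l → piF θ l = 2 * F (1 / l) := by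
    intro l hl
    simp only [piF, hF]
    congr 1
    exact setIntegral_congr_fun measurableSet_Ioi
      fun x hx => hθg x ((one_div_pos.2 hl).trans hx)
  have hul : ∀ l : ℝ, 2 < l → 0 < 1 / l ∧ 1 / l ≤ b 1 ∧ (1 / l) ^ (-a1) = l ^ a1 := by
    intro l hl
    have hl0 : 0 < l := by linarith
    refine ⟨by positivity, ?_, ?_⟩
    · rw [hb1]
      exact one_div_le_one_div_of_le (by norm_num) hl.le
    · rw [one_div, Real.inv_rpow hl0.le, Real.rpow_neg hl0.le, inv_inv]
  -- V and W
  have hwi : ∀ a : ℝ, a < 2 → ∀ u : ℝ, 0 ≤ u →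
      IntegrableOn (fun x : ℝ => x ^ (-(a - 1))) (Set.Ioc 0 u) := by
    intro a ha u hu
    rw [← intervalIntegrable_iff_integrableOn_Ioc_of_le hu]
    exact intervalIntegral.intervalIntegrable_rpow' (by linarith)
  have hsq : ∀ x : ℝ, 0 < x → ∀ a : ℝ, x ^ 2 * x ^ (-a - 1) = x ^ (-(a - 1)) := by
    intro x hx a
    rw [← Real.rpow_natCast x 2, ← Real.rpow_add hx]
    congr 1
    push_cast
    ring
  set g2 : ℝ → ℝ := fun x => x ^ 2 * g x with hg2
  have hg2pos : ∀ x : ℝ, 0 < x → 0 ≤ g2 x := fun x hx => mul_nonneg (by positivity) (hgpos x hx)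
  have hg2up : ∀ x : ℝ, 0 < x → g2 x ≤ x ^ (-(a1 - 1)) + x ^ (-(a2 - 1)) := by
    intro x hx
    rw [← hsq x hx, ← hsq x hx, ← mul_add]
    exact mul_le_mul_of_nonneg_left (hgup x hx) (by positivity)
  have hg2i : ∀ u : ℝ, 0 ≤ u → IntegrableOn g2 (Set.Ioc 0 u) := by
    intro u hu
    refine Integrable.mono' ((hwi a1 (by linarith) u hu).add (hwi a2 ha2 u hu))
      (by fun_prop) ?_
    refine (ae_restrict_iff' measurableSet_Ioc).2 (Eventually.of_forall fun x hx => ?_)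
    rw [Real.norm_eq_abs, abs_of_nonneg (hg2pos x hx.1)]
    exact hg2up x hx.1
  set V : ℝ → ℝ := fun u => ∫ x in Set.Ioc 0 u, g2 x with hV
  set W : ℝ → ℝ := fun u => ∫ x in Set.Ioc 0 u, x ^ (-(a1 - 1)) with hW
  have hwe : ∀ a : ℝ, a < 2 → ∀ u : ℝ, 0 ≤ u →
      ∫ x in Set.Ioc 0 u, x ^ (-(a - 1)) = u ^ (2 - a) / (2 - a) := by
    intro a ha u hu
    rw [← intervalIntegral.integral_of_le hu, integral_rpow (Or.inl (by linarith))]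
    have : -(a - 1) + 1 = 2 - a := by ring
    rw [this, Real.zero_rpow (by linarith), sub_zero]
  have hWe : ∀ u : ℝ, 0 ≤ u → W u = u ^ (2 - a1) / (2 - a1) := hwe a1 (by linarith)
  have hsplit2 : ∀ f : ℝ → ℝ, ∀ u v : ℝ, 0 ≤ u → u ≤ v → IntegrableOn f (Set.Ioc 0 v) →
      ∫ x in Set.Ioc 0 v, f x = (∫ x in Set.Ioc 0 u, f x) + ∫ x in Set.Ioc u v, f x := by
    intro f u v hu huv hf
    rw [← Set.Ioc_union_Ioc_eq_Ioc hu huv, setIntegral_union (Set.Ioc_disjoint_Ioc_of_le le_rfl)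
      measurableSet_Ioc (hf.mono_set (Set.Ioc_subset_Ioc_right huv))
      (hf.mono_set (Set.Ioc_subset_Ioc_left hu))]
  have hVs : ∀ u v : ℝ, 0 < u → u ≤ v → V v = V u + ∫ x in Set.Ioc u v, g2 x :=
    fun u v hu huv => hsplit2 g2 u v hu.le huv (hg2i v (hu.le.trans huv))
  have hWs : ∀ u v : ℝ, 0 < u → u ≤ v → W v = W u + ∫ x in Set.Ioc u v, x ^ (-(a1 - 1)) :=
    fun u v hu huv => hsplit2 _ u v hu.le huv (hwi a1 (by linarith) v (hu.le.trans huv))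
  have hWmono : ∀ u v : ℝ, 0 < u → u ≤ v → W u ≤ W v := by
    intro u v hu huv
    rw [hWs u v hu huv]
    have : 0 ≤ ∫ x in Set.Ioc u v, x ^ (-(a1 - 1)) :=
      setIntegral_nonneg measurableSet_Ioc fun x hx => Real.rpow_nonneg (hu.trans hx.1).le _
    linarith
  have hVmono : ∀ u v : ℝ, 0 < u → u ≤ v → V u ≤ V v := by
    intro u v hu huv
    rw [hVs u v hu huv]
    have : 0 ≤ ∫ x in Set.Ioc u v, g2 x :=
      setIntegral_nonneg measurableSet_Ioc fun x hx => hg2pos x (hu.trans hx.1)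
    linarith
  have hVpos : ∀ u : ℝ, 0 ≤ V u := fun u =>
    setIntegral_nonneg measurableSet_Ioc fun x hx => hg2pos x hx.1
  have hWpos : ∀ u : ℝ, 0 ≤ W u := fun u =>
    setIntegral_nonneg measurableSet_Ioc fun x hx => Real.rpow_nonneg hx.1.le _
  have hgoodV : ∀ k : ℕ, ∀ u : ℝ, u ≤ b (2 * k + 1) →
      ∫ x in Set.Ioc (b (2 * k + 2)) u, g2 x
        = ∫ x in Set.Ioc (b (2 * k + 2)) u, x ^ (-(a1 - 1)) :=
    fun k u hu => setIntegral_congr_fun measurableSet_Ioc fun x hx => by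
      have hx0 : 0 < x := (hbpos _).trans hx.1
      simp only [hg2]
      rw [hgood k x ⟨hx.1, hx.2.trans hu⟩, hsq x hx0]
  have hbadV : ∀ k : ℕ, ∫ x in Set.Ioc (b (2 * k + 3)) (b (2 * k + 2)), g2 x
      ≤ W (b (2 * k + 3)) := by
    intro k
    have h1 := hbint2 (k + 1) (by omega)
    have i1 : 2 * (k + 1) + 1 = 2 * k + 3 := by ring
    have i2 : 2 * (k + 1) = 2 * k + 2 := by ring
    rw [i1, i2] at h1
    refine le_trans (le_of_eq ?_) h1
    refine setIntegral_congr_fun measurableSet_Ioc fun x hx => ?_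
    have hx0 : 0 < x := (hbpos _).trans hx.1
    simp only [hg2]
    rw [hbad (k + 1) x hx, hsq x hx0]
  set r : ℝ := (1 / 2 : ℝ) ^ (2 - a1) with hr
  have hr1 : r < 1 := Real.rpow_lt_one (by norm_num) (by norm_num) (by linarith)
  have hWr : ∀ n : ℕ, W (b (2 * n + 3)) ≤ r * W (b (2 * n + 1)) := by
    intro n
    have h1 := hbgap (n + 1) (by omega)
    have i2 : 2 * (n + 1) = 2 * n + 2 := by ring
    have i3 : 2 * n + 2 - 1 = 2 * n + 1 := by omega
    rw [i2, i3] at h1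
    have h2 : b (2 * n + 1) / (((n + 1 : ℕ) : ℝ) + 1) ≤ 1 / 2 * b (2 * n + 1) := by
      rw [div_eq_mul_one_div, mul_comm]
      refine mul_le_mul_of_nonneg_right ?_ (hbpos _).le
      refine one_div_le_one_div_of_le (by norm_num) ?_
      push_cast
      have : (0 : ℝ) ≤ n := Nat.cast_nonneg n
      linarith
    have h3 := hbm (2 * n + 2) (2 * n + 3) (by omega)
    have hp := hbpos (2 * n + 1)
    have h4 : b (2 * n + 3) ^ (2 - a1) ≤ (1 / 2 * b (2 * n + 1)) ^ (2 - a1) :=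
      Real.rpow_le_rpow (hbpos _).le (by linarith) (by linarith)
    rw [Real.mul_rpow (by norm_num) hp.le] at h4
    rw [hWe _ (hbpos _).le, hWe _ hp.le, ← mul_div_assoc]
    exact div_le_div_of_nonneg_right h4 (by linarith)
  set D : ℝ := 1 / (1 - r) with hD
  have hDpos : 0 < D := one_div_pos.2 (by linarith)
  have hstep : ∀ n : ℕ, V (b (2 * n + 1)) - D * W (b (2 * n + 1))
      ≤ V (b (2 * (n + 1) + 1)) - D * W (b (2 * (n + 1) + 1)) := by
    intro n
    have i1 : 2 * (n + 1) + 1 = 2 * n + 3 := by ring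
    rw [i1]
    have e1 := hVs (b (2 * n + 3)) (b (2 * n + 2)) (hbpos _) (hbm _ _ (by omega))
    have e2 := hVs (b (2 * n + 2)) (b (2 * n + 1)) (hbpos _) (hbm _ _ (by omega))
    have e3 := hWs (b (2 * n + 2)) (b (2 * n + 1)) (hbpos _) (hbm _ _ (by omega))
    have e4 := hgoodV n _ le_rfl
    have e5 := hbadV n
    have e6 := hWmono (b (2 * n + 3)) (b (2 * n + 2)) (hbpos _) (hbm _ _ (by omega))
    have e7 : W (b (2 * n + 1)) = D * (1 - r) * W (b (2 * n + 1)) := by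
      rw [hD, one_div, inv_mul_cancel₀ (by linarith), one_mul]
    have e8 := mul_le_mul_of_nonneg_left (hWr n) hDpos.le
    have e9 : D * (1 - r) * W (b (2 * n + 1))
      = D * W (b (2 * n + 1)) - D * (r * W (b (2 * n + 1))) := by ring
    linarith
  have hVW : ∀ u : ℝ, 0 ≤ u → V u ≤ u ^ (2 - a1) / (2 - a1) + u ^ (2 - a2) / (2 - a2) := by
    intro u hu
    rw [← hwe a1 (by linarith) u hu, ← hwe a2 ha2 u hu,
      ← integral_add (hwi a1 (by linarith) u hu) (hwi a2 ha2 u hu)]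
    exact setIntegral_mono_on (hg2i u hu)
      ((hwi a1 (by linarith) u hu).add (hwi a2 ha2 u hu)) measurableSet_Ioc
      fun x hx => hg2up x hx.1
  have hbodd : Tendsto (fun n : ℕ => b (2 * n + 1)) atTop (𝓝 0) :=
    hblim.comp (tendsto_atTop_mono (fun n => by simp only [id]; omega) tendsto_id)
  have hpt : ∀ a : ℝ, a < 2 →
      Tendsto (fun n : ℕ => b (2 * n + 1) ^ (2 - a) / (2 - a)) atTop (𝓝 0) := by
    intro a ha
    have h1 := (hbodd.rpow_const (p := 2 - a) (Or.inr (by linarith))).div_const (2 - a)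
    rwa [Real.zero_rpow (by linarith), zero_div] at h1
  have hVb : ∀ n : ℕ, V (b (2 * n + 1)) ≤ D * W (b (2 * n + 1)) := by
    intro n
    have hmono : Monotone (fun n : ℕ => V (b (2 * n + 1)) - D * W (b (2 * n + 1))) :=
      monotone_nat_of_le_succ hstep
    have hV0 : Tendsto (fun n : ℕ => V (b (2 * n + 1))) atTop (𝓝 0) := by
      refine tendsto_of_tendsto_of_tendsto_of_le_of_le tendsto_const_nhds
        (g := fun _ => (0 : ℝ)) (h := fun n : ℕ => b (2 * n + 1) ^ (2 - a1) / (2 - a1)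
          + b (2 * n + 1) ^ (2 - a2) / (2 - a2)) ?_ (fun n => hVpos _)
          (fun n => hVW _ (hbpos _).le)
      have := (hpt a1 (by linarith)).add (hpt a2 ha2)
      rwa [add_zero] at this
    have hW0 : Tendsto (fun n : ℕ => W (b (2 * n + 1))) atTop (𝓝 0) := by
      refine (hpt a1 (by linarith)).congr fun n => ?_
      rw [hWe _ (hbpos _).le]
    have hlim := hV0.sub (hW0.const_mul D)
    rw [mul_zero, sub_zero] at hlim
    have := hmono.ge_of_tendsto hlim n
    linarith
  have hVu : ∀ u : ℝ, 0 < u → u ≤ b 1 → V u ≤ (D + 2) * W u := by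
    intro u hu hu1
    obtain ⟨k, hk1, hk2⟩ := hloc u hu hu1
    have e1 := hVs (b (2 * k + 3)) (b (2 * k + 2)) (hbpos _) (hbm _ _ (by omega))
    have e2 := hbadV k
    have e3 : V (b (2 * k + 3)) ≤ D * W (b (2 * k + 3)) := hVb (k + 1)
    have e4 := hWmono (b (2 * k + 3)) u (hbpos _) hk1.le
    have e5 := mul_le_mul_of_nonneg_left e4 hDpos.le
    have e6 := hWpos u
    rcases le_or_gt u (b (2 * k + 2)) with h2 | h2
    · have e7 := hVmono _ _ hu h2
      linarith
    · have e7 := hVs (b (2 * k + 2)) u (hbpos _) h2.le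
      have e8 := hWs (b (2 * k + 2)) u (hbpos _) h2.le
      have e9 := hgoodV k u hk2
      have e10 := hWpos (b (2 * k + 2))
      linarith
  -- psi
  set q : ℝ → ℝ → ℝ := fun l x => (1 - Real.cos (x * l)) * g x with hq
  have hpsi : ∀ l : ℝ, psiF θ l = ∫ x in Set.Ioi (0 : ℝ), q l x := by
    intro l
    refine setIntegral_congr_fun measurableSet_Ioi fun x hx => ?_
    simp only [hq]
    rw [← hθg x hx, mul_one_div]
  have hcos : ∀ y : ℝ, 0 ≤ 1 - Real.cos y := fun y => by linarith [Real.cos_le_one y]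
  have hqpos : ∀ l x : ℝ, 0 < x → 0 ≤ q l x := fun l x hx => mul_nonneg (hcos _) (hgpos x hx)
  have hqm : ∀ l : ℝ, Measurable (q l) := fun l => by
    simp only [hq]
    fun_prop
  have hq1 : ∀ l x : ℝ, 0 < x → q l x ≤ l ^ 2 / 2 * g2 x := by
    intro l x hx
    have h1 := Real.one_sub_sq_div_two_le_cos (x := x * l)
    have h2 : 1 - Real.cos (x * l) ≤ l ^ 2 / 2 * x ^ 2 := by
      have : (x * l) ^ 2 / 2 = l ^ 2 / 2 * x ^ 2 := by ring
      linarith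
    have h3 := mul_le_mul_of_nonneg_right h2 (hgpos x hx)
    simp only [hq, hg2]
    linarith
  have hq2 : ∀ l x : ℝ, 0 < x → q l x ≤ 2 * g x := by
    intro l x hx
    exact mul_le_mul_of_nonneg_right (by linarith [Real.neg_one_le_cos (x * l)]) (hgpos x hx)
  have hqi1 : ∀ l u : ℝ, 0 ≤ u → IntegrableOn (q l) (Set.Ioc 0 u) := by
    intro l u hu
    refine Integrable.mono' ((hg2i u hu).const_mul (l ^ 2 / 2)) (hqm l).aestronglyMeasurable ?_
    refine (ae_restrict_iff' measurableSet_Ioc).2 (Eventually.of_forall fun x hx => ?_)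
    rw [Real.norm_eq_abs, abs_of_nonneg (hqpos l x hx.1)]
    exact hq1 l x hx.1
  have hqi2 : ∀ l u : ℝ, 0 < u → IntegrableOn (q l) (Set.Ioi u) := by
    intro l u hu
    refine Integrable.mono' ((hgi u hu).const_mul 2) (hqm l).aestronglyMeasurable ?_
    refine (ae_restrict_iff' measurableSet_Ioi).2 (Eventually.of_forall fun x hx => ?_)
    have hx0 : 0 < x := hu.trans hx
    rw [Real.norm_eq_abs, abs_of_nonneg (hqpos l x hx0)]
    exact hq2 l x hx0
  have hqi : ∀ l : ℝ, IntegrableOn (q l) (Set.Ioi 0) := by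
    intro l
    rw [← Set.Ioc_union_Ioi_eq_Ioi (zero_le_one' ℝ)]
    exact (hqi1 l 1 zero_le_one).union (hqi2 l 1 zero_lt_one)
  have hpsiup : ∀ l : ℝ, 2 < l →
      psiF θ l ≤ ((D + 2) / (2 - a1) / 2 + 2 * C0) * l ^ a1 := by
    intro l hl
    obtain ⟨hu, hu1, hul1⟩ := hul l hl
    have hl0 : 0 < l := by linarith
    rw [hpsi l, hsplit (q l) 0 (1 / l) hu.le (hqi l)]
    have e1 : ∫ x in Set.Ioc 0 (1 / l), q l x ≤ l ^ 2 / 2 * V (1 / l) := by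
      simp only [hV]
      rw [← integral_const_mul]
      exact setIntegral_mono_on (hqi1 l _ hu.le) ((hg2i _ hu.le).const_mul _) measurableSet_Ioc
        fun x hx => hq1 l x hx.1
    have e2 : ∫ x in Set.Ioi (1 / l), q l x ≤ 2 * F (1 / l) := by
      simp only [hF]
      rw [← integral_const_mul]
      exact setIntegral_mono_on (hqi2 l _ hu) ((hgi _ hu).const_mul _) measurableSet_Ioi
        fun x hx => hq2 l x (hu.trans hx)
    have e3 := hFfin _ hu hu1
    rw [hul1] at e3
    have e4 := hVu _ hu hu1
    rw [hWe _ hu.le] at e4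
    have e5 : l ^ 2 * (1 / l) ^ (2 - a1) = l ^ a1 := by
      rw [one_div, Real.inv_rpow hl0.le, ← Real.rpow_neg hl0.le, ← Real.rpow_natCast l 2,
        ← Real.rpow_add hl0]
      congr 1
      push_cast
      ring
    have e6 : l ^ 2 / 2 * V (1 / l) ≤ (D + 2) / (2 - a1) / 2 * l ^ a1 := by
      refine (mul_le_mul_of_nonneg_left e4 (by positivity)).trans (le_of_eq ?_)
      rw [← e5]
      ring
    calc _ ≤ (D + 2) / (2 - a1) / 2 * l ^ a1 + 2 * (C0 * l ^ a1) := by linarith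
      _ = _ := by ring
  set κ : ℝ := 1 - Real.cos 1 with hκ
  have hκpos : 0 < κ := by
    have := Real.cos_one_le
    rw [hκ]
    linarith
  have hpsilow : ∀ l : ℝ, 2 < l → κ * 2 ^ (-a1 - 1) * l ^ a1 ≤ psiF θ l := by
    intro l hl
    have hl0 : 0 < l := by linarith
    have hu : 0 < 1 / l := by positivity
    have hsub : Set.Ioc (1 / l) (2 / l) ⊆ Set.Ioi 0 := fun x hx => hu.trans hx.1
    have e1 : ∫ x in Set.Ioc (1 / l) (2 / l), q l x ≤ psiF θ l := by
      rw [hpsi l]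
      refine setIntegral_mono_set (hqi l) ?_ hsub.eventuallyLE
      exact (ae_restrict_iff' measurableSet_Ioi).2 (Eventually.of_forall fun x hx => hqpos l x hx)
    refine le_trans ?_ e1
    have e2 : ∫ _x in Set.Ioc (1 / l) (2 / l), κ * (2 / l) ^ (-a1 - 1)
        ≤ ∫ x in Set.Ioc (1 / l) (2 / l), q l x := by
      refine setIntegral_mono_on (integrableOn_const (by simp)) ((hqi l).mono_set hsub)
        measurableSet_Ioc fun x hx => ?_
      have hx0 : 0 < x := hu.trans hx.1
      have h1 : 1 ≤ x * l := by
        have := hx.1.le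
        rwa [div_le_iff₀ hl0] at this
      have h2 : x * l ≤ 2 := by
        have := hx.2
        rwa [le_div_iff₀ hl0] at this
      have h3 : Real.cos (x * l) ≤ Real.cos 1 :=
        Real.cos_le_cos_of_nonneg_of_le_pi (by norm_num) (by linarith [Real.pi_gt_three]) h1
      have h4 : (2 / l) ^ (-a1 - 1) ≤ x ^ (-a1 - 1) :=
        Real.rpow_le_rpow_of_nonpos hx0 hx.2 (by linarith)
      exact mul_le_mul (by rw [hκ]; linarith) (h4.trans (hglow x hx0))
        (Real.rpow_nonneg (by positivity) _) (hcos _)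
    refine le_trans (le_of_eq ?_) e2
    rw [setIntegral_const, Measure.real, Real.volume_Ioc, ENNReal.toReal_ofReal
      (by rw [← sub_div]; norm_num; exact hl0.le), smul_eq_mul, Real.div_rpow (by norm_num) hl0.le]
    have e3 : l ^ a1 = l⁻¹ / l ^ (-a1 - 1) := by
      rw [← Real.rpow_neg_one, ← Real.rpow_sub hl0]
      congr 1
      ring
    rw [e3]
    ring
  have hlapos : ∀ l : ℝ, 2 < l → 0 < l ^ a1 := fun l hl => Real.rpow_pos_of_pos (by linarith) _
  have hpilow : ∀ l : ℝ, 2 < l → 2 / a1 * l ^ a1 ≤ piF θ l := by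
    intro l hl
    obtain ⟨hu, hu1, hul1⟩ := hul l hl
    have h1 := hGF _ hu
    rw [hGe _ hu, hul1] at h1
    rw [hpiF l (by linarith)]
    calc _ = 2 * (l ^ a1 / a1) := by ring
      _ ≤ _ := by linarith
  have hpiup : ∀ l : ℝ, 2 < l → piF θ l ≤ 2 * C0 * l ^ a1 := by
    intro l hl
    obtain ⟨hu, hu1, hul1⟩ := hul l hl
    have h1 := hFfin _ hu hu1
    rw [hul1] at h1
    rw [hpiF l (by linarith)]
    linarith
  have hC0pos : 0 < C0 := by positivity
  have hfreq : ∀ M : ℝ, ∃ᶠ x in 𝓝[>] (0 : ℝ), M < (x / θ x) / piF θ (1 / x) := by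
    intro M
    have hbe : Tendsto (fun n : ℕ => b (2 * n + 2)) atTop (𝓝[>] 0) := by
      refine tendsto_nhdsWithin_iff.2 ⟨?_, Eventually.of_forall fun n => hbpos _⟩
      exact hblim.comp (tendsto_atTop_mono (fun n => by simp only [id]; omega) tendsto_id)
    refine hbe.frequently (Eventually.frequently ?_)
    have hbig : Tendsto (fun n : ℕ => b (2 * n + 2) ^ (a1 - a2)) atTop atTop :=
      (tendsto_rpow_neg_nhdsGT_zero (by linarith)).comp hbe
    filter_upwards [hbig.eventually_gt_atTop (M * (2 * C0))] with n hn
    have hx0 := hbpos (2 * n + 2)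
    have hxm : b (2 * n + 2) ∈ Set.Ioc (b (2 * (n + 1) + 1)) (b (2 * (n + 1))) :=
      ⟨hbanti (by omega), le_rfl⟩
    have hx1 : b (2 * n + 2) < b 1 := hbanti (by omega)
    rw [hθ2 _ _ hxm]
    set x := b (2 * n + 2) with hx
    have hlx : 2 < 1 / x := by
      rw [lt_div_iff₀ hx0]
      rw [hb1] at hx1
      linarith
    have h1 := hpiup _ hlx
    have h0 : 0 < piF θ (1 / x) :=
      (mul_pos (by positivity) (hlapos _ hlx)).trans_le (hpilow _ hlx)
    have h2 : (1 / x) ^ a1 = x ^ (-a1) := by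
      rw [one_div, Real.inv_rpow hx0.le, Real.rpow_neg hx0.le]
    have h3 : x / x ^ (a2 + 1) = x ^ (-a2) := by
      rw [Real.rpow_add_one hx0.ne', Real.rpow_neg hx0.le]
      field_simp
    have hxa := Real.rpow_pos_of_pos hx0 (-a1)
    have h4 : x ^ (-a2) = x ^ (a1 - a2) * x ^ (-a1) := by
      rw [← Real.rpow_add hx0]
      congr 1
      ring
    rw [h2] at h1
    rw [h3, lt_div_iff₀ h0, h4]
    rcases le_or_gt M 0 with hM | hM
    · have : 0 < x ^ (a1 - a2) * x ^ (-a1) := mul_pos (Real.rpow_pos_of_pos hx0 _) hxa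
      nlinarith
    · calc M * piF θ (1 / x) ≤ M * (2 * C0 * x ^ (-a1)) := mul_le_mul_of_nonneg_left h1 hM.le
        _ = M * (2 * C0) * x ^ (-a1) := by ring
        _ < _ := mul_lt_mul_of_pos_right hn hxa
  have h3pos : (2 : ℝ) < 3 := by norm_num
  refine ⟨⟨2 / a1, 2 * C0, by positivity, ?_, 2, fun l hl => ⟨hpilow l hl, hpiup l hl⟩⟩,
    ⟨κ * 2 ^ (-a1 - 1), (D + 2) / (2 - a1) / 2 + 2 * C0,
      mul_pos hκpos (Real.rpow_pos_of_pos (by norm_num) _), ?_, 2,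
      fun l hl => ⟨hpsilow l hl, hpsiup l hl⟩⟩, hfreq, ?_⟩
  · exact le_of_mul_le_mul_right ((hpilow 3 h3pos).trans (hpiup 3 h3pos)) (hlapos 3 h3pos)
  · exact le_of_mul_le_mul_right ((hpsilow 3 h3pos).trans (hpsiup 3 h3pos)) (hlapos 3 h3pos)
  · rintro al ah ⟨-, -, -, ⟨M, hM⟩, -⟩
    rw [eventually_map] at hM
    obtain ⟨x, hx1, hx2⟩ := ((hfreq M).and_eventually hM).exists
    exact absurd hx1 (not_lt.2 hx2)
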